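/- The Robinson–Schensted–Knuth correspondence w ↦ (P(w), Q(w)) is a bijection from the symmetric group S_n onto the set of pairs (P, Q) of standard Young tableaux with n boxes having the same shape. -/

import Mathlib

/-- `l` is (the list of parts of) a partition of `n`. -/
def IsPartitionList (n : ℕ) (l : List ℕ) : Prop :=
  l.Chain' (· ≥ ·) ∧ (∀ a ∈ l, 0 < a) ∧ l.sum = n

/-- dominance order on lists of parts, via partial sums. -/
def listDom (a b : List ℕ) : Prop := ∀ i, (b.take i).sum ≤ (a.take i).sum

/-- number of parts of `l` that are `> c`, i.e. the `(c+1)`-st part of the conjugate. -/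
def conjCount (l : List ℕ) (c : ℕ) : ℕ := (l.filter (fun a => c < a)).length

/-- the conjugate partition, as a list. -/
def conjP (l : List ℕ) : List ℕ := (List.range (l.headD 0)).map (conjCount l)

/-- shape of a tableau given as a list of rows. -/
def shape (t : List (List ℕ)) : List ℕ := t.map List.length

/-- `t` is a standard Young tableau with `n` boxes and entries `1,…,n`. -/
def IsStdTableau (n : ℕ) (t : List (List ℕ)) : Prop :=
  t.flatten.Perm ((List.range n).map (· + 1)) ∧
  (∀ r ∈ t, r.Chain' (· < ·)) ∧
  (∀ i j, j < (t.getD (i + 1) []).length →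
      (t.getD i []).getD j 0 < (t.getD (i + 1) []).getD j 0) ∧
  (shape t).Chain' (· ≥ ·) ∧ (∀ r ∈ t, r ≠ [])

/-- the subtableau `t↓ₘ` consisting of the entries `1,…,m`. -/
def restrictTab (t : List (List ℕ)) (m : ℕ) : List (List ℕ) :=
  (t.map (fun r => r.filter (· ≤ m))).filter (fun r => ¬ r = [])

/-- dominance order on standard tableaux with `n` boxes:
`s ⊵ t` iff `Shape(s↓ₖ) ⊵ Shape(t↓ₖ)` for all `1 ≤ k ≤ n`. -/
def tabDom (n : ℕ) (s t : List (List ℕ)) : Prop :=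
  ∀ k, 1 ≤ k → k ≤ n → listDom (shape (restrictTab s k)) (shape (restrictTab t k))

def rowTabAux : ℕ → List ℕ → List (List ℕ)
  | _, [] => []
  | s, a :: as => ((List.range a).map (fun j => s + j + 1)) :: rowTabAux (s + a) as

/-- the initial (row-reading) tableau `t^λ`. -/
def rowTab (l : List ℕ) : List (List ℕ) := rowTabAux 0 l

/-- the column-reading tableau `t_λ`. -/
def colTab (l : List ℕ) : List (List ℕ) :=
  (List.range l.length).map (fun i =>
    (List.range (l.getD i 0)).map (fun j =>
      ((List.range j).map (conjCount l)).sum + i + 1))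

/-- the conjugate (transpose) tableau `t*`. -/
def conjTab (t : List (List ℕ)) : List (List ℕ) :=
  (List.range (t.headD []).length).map (fun j => t.filterMap (fun r => r[j]?))

/-- Schensted insertion of `x` into a row: new row plus optionally bumped entry. -/
def rowInsert : List ℕ → ℕ → List ℕ × Option ℕ
  | [], x => ([x], none)
  | a :: as, x =>
    if a < x then
      let p := rowInsert as x
      (a :: p.1, p.2)
    else (x :: as, some a)

/-- Schensted row-insertion of `x` into a tableau. -/
def insertTab : List (List ℕ) → ℕ → List (List ℕ)
  | [], x => [[x]]
  | r :: rest, x =>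
    match rowInsert r x with
    | (r', none) => r' :: rest
    | (r', some y) => r' :: insertTab rest y

/-- place the entry `k` at the end of row `r` of `q`. -/
def placeAt : List (List ℕ) → ℕ → ℕ → List (List ℕ)
  | [], _, k => [[k]]
  | q :: qs, 0, k => (q ++ [k]) :: qs
  | q :: qs, r + 1, k => q :: placeAt qs r k

/-- index of the row in which the two shapes differ. -/
def diffRow : List ℕ → List ℕ → ℕ
  | _, [] => 0
  | [], _ :: _ => 0
  | a :: as, b :: bs => if a = b then diffRow as bs + 1 else 0

/-- one step of RSK: insert `x` into `P` and record `k` in `Q`. -/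
def RSKstep (pq : List (List ℕ) × List (List ℕ)) (x k : ℕ) :
    List (List ℕ) × List (List ℕ) :=
  let P' := insertTab pq.1 x
  (P', placeAt pq.2 (diffRow (shape pq.1) (shape P')) k)

/-- RSK applied to the sequence `xs` (with recording entries `1, 2, …`). -/
def RSKfold (xs : List ℕ) : List (List ℕ) × List (List ℕ) :=
  (xs.zip (List.range xs.length)).foldl (fun pq p => RSKstep pq p.1 (p.2 + 1)) ([], [])

/-- the RSK insertion tableau `P(w)`. -/
def Ptab {n : ℕ} (w : Equiv.Perm (Fin n)) : List (List ℕ) :=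
  (RSKfold (List.ofFn (fun i => (w i : ℕ) + 1))).1

/-- the RSK recording tableau `Q(w)`. -/
def Qtab {n : ℕ} (w : Equiv.Perm (Fin n)) : List (List ℕ) :=
  (RSKfold (List.ofFn (fun i => (w i : ℕ) + 1))).2

/-- Coxeter length of a permutation = number of inversions. -/
def invCount {n : ℕ} (w : Equiv.Perm (Fin n)) : ℕ :=
  (Finset.univ.filter (fun p : Fin n × Fin n => p.1 < p.2 ∧ w p.2 < w p.1)).card

/-- one step in the Bruhat order: multiply by a reflection, increasing length. -/
def bruhatStep {n : ℕ} (x y : Equiv.Perm (Fin n)) : Prop :=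
  (∃ i j : Fin n, i ≠ j ∧ y = x * Equiv.swap i j) ∧ invCount x < invCount y

/-- strict Bruhat order. -/
def bruhatLT {n : ℕ} (x y : Equiv.Perm (Fin n)) : Prop :=
  Relation.TransGen bruhatStep x y

/-- Row `r` may stand directly above row `s` in a column-strict tableau. -/
def RowAbove (r s : List ℕ) : Prop :=
  ∀ (j b : ℕ), s[j]? = some b → ∃ a, r[j]? = some a ∧ a < b

/-- Row- and column-strict tableaux with arbitrary entries and no empty rows. -/
def IsStrictTableau : List (List ℕ) → Prop
  | [] => True
  | r :: rest => r.Pairwise (· < ·) ∧ r ≠ [] ∧ RowAbove r (rest.headD []) ∧ IsStrictTableau rest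

/-- `RowStep s x s'` says that inserting `x` into the row `s` produces the third argument. -/
def RowStep (s : List ℕ) (x : ℕ) (s' : List ℕ) : Prop :=
  (s' = s ++ [x] ∧ ∀ a ∈ s, a < x) ∨
    ∃ l y m, s = l ++ y :: m ∧ s' = l ++ x :: m ∧ (∀ a ∈ l, a < x) ∧ x < y

/-- Row insertion of `x` into `t` gives `t'`, the new box being in row `i`. -/
inductive Inserts : List (List ℕ) → ℕ → List (List ℕ) → ℕ → Prop
  | nil (x : ℕ) : Inserts [] x [[x]] 0
  | append {r : List ℕ} {rest : List (List ℕ)} {x : ℕ} (h : ∀ a ∈ r, a < x) :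
      Inserts (r :: rest) x ((r ++ [x]) :: rest) 0
  | bump {l m : List ℕ} {rest rest' : List (List ℕ)} {x y i : ℕ} (hl : ∀ a ∈ l, a < x)
      (hxy : x < y) (h : Inserts rest y rest' i) :
      Inserts ((l ++ y :: m) :: rest) x ((l ++ x :: m) :: rest') (i + 1)

/-- Add a box at the end of row `i` of a shape. -/
def addBox : List ℕ → ℕ → List ℕ
  | [], _ => [1]
  | a :: as, 0 => (a + 1) :: as
  | a :: as, i + 1 => a :: addBox as i

theorem diffRow_addBox (l : List ℕ) (i : ℕ) (h : i ≤ l.length) :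
    diffRow l (addBox l i) = i := by
  induction l generalizing i with
  | nil => simp_all [addBox, diffRow]
  | cons a as ih => cases i <;> simp_all [addBox, diffRow]

theorem addBox_ne_nil (l : List ℕ) (i : ℕ) : addBox l i ≠ [] := by
  fun_cases addBox l i <;> simp

theorem addBox_injective {l l' : List ℕ} {i : ℕ} (hl : ∀ a ∈ l, 0 < a) (hl' : ∀ a ∈ l', 0 < a)
    (h : addBox l i = addBox l' i) : l = l' := by
  induction l generalizing i l' with
  | nil =>
    cases l' with
    | nil => rfl
    | cons b bs =>
      cases i with
      | zero => simp_all [addBox]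
      | succ i =>
        simp only [addBox, List.cons.injEq] at h
        exact absurd h.2.symm (addBox_ne_nil _ _)
  | cons a as ih =>
    cases l' with
    | nil =>
      cases i with
      | zero => simp_all [addBox]
      | succ i =>
        simp only [addBox, List.cons.injEq] at h
        exact absurd h.2 (addBox_ne_nil _ _)
    | cons b bs =>
      cases i with
      | zero => simp_all [addBox]
      | succ i =>
        simp only [addBox, List.cons.injEq] at h
        rw [h.1, ih (fun c hc => hl c (by simp [hc])) (fun c hc => hl' c (by simp [hc])) h.2]

theorem shape_placeAt (q : List (List ℕ)) (i k : ℕ) :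
    shape (placeAt q i k) = addBox (shape q) i := by
  induction q generalizing i with
  | nil => simp [placeAt, shape, addBox]
  | cons r q ih => cases i <;> simp_all [placeAt, shape, addBox]

theorem perm_placeAt (q : List (List ℕ)) (i k : ℕ) :
    (placeAt q i k).flatten.Perm (k :: q.flatten) := by
  induction q generalizing i with
  | nil => simp [placeAt]
  | cons r q ih =>
    cases i with
    | zero => simp [placeAt, List.perm_middle]
    | succ i =>
      exact ((ih i).append_left r).trans List.perm_middle

theorem Inserts.shape_eq {t t' : List (List ℕ)} {x i : ℕ} (h : Inserts t x t' i) :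
    shape t' = addBox (shape t) i := by
  induction h with
  | nil x => rfl
  | append h => simp [shape, addBox]
  | bump hl hxy h ih => simp_all [shape, addBox]

theorem Inserts.le_length {t t' : List (List ℕ)} {x i : ℕ} (h : Inserts t x t' i) :
    i ≤ t.length := by
  induction h <;> simp_all

theorem Inserts.perm {t t' : List (List ℕ)} {x i : ℕ} (h : Inserts t x t' i) :
    t'.flatten.Perm (x :: t.flatten) := by
  induction h with
  | nil x => simp
  | append h => simp [List.perm_middle]
  | @bump l m rest rest' x y i hl hxy h ih =>
    simp only [List.flatten_cons, List.append_assoc, List.cons_append]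
    refine List.perm_middle.trans (List.Perm.cons _ ?_)
    refine List.Perm.append_left l ?_
    exact (ih.append_left m).trans List.perm_middle

theorem Inserts.rowStep {t t' : List (List ℕ)} {x i : ℕ} (h : Inserts t x t' i) :
    RowStep (t.headD []) x (t'.headD []) := by
  cases h with
  | nil x => left; simp
  | append h => left; simpa using h
  | bump hl hxy h => right; exact ⟨_, _, _, rfl, rfl, hl, hxy⟩

theorem rowInsert_append (r : List ℕ) (x : ℕ) (h : ∀ a ∈ r, a < x) :
    rowInsert r x = (r ++ [x], none) := by
  induction r <;> simp_all [rowInsert]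

theorem rowInsert_bump (l m : List ℕ) (x y : ℕ) (h : ∀ a ∈ l, a < x) (hxy : x < y) :
    rowInsert (l ++ y :: m) x = (l ++ x :: m, some y) := by
  induction l <;> simp_all [rowInsert, hxy.le]

theorem Inserts.insertTab_eq {t t' : List (List ℕ)} {x i : ℕ} (h : Inserts t x t' i) :
    insertTab t x = t' := by
  induction h with
  | nil x => rfl
  | append h => simp [insertTab, rowInsert_append _ _ h]
  | bump hl hxy h ih => simp [insertTab, rowInsert_bump _ _ _ _ hl hxy, ih]

theorem RSKstep_eq {t t' q : List (List ℕ)} {x i : ℕ} (k : ℕ) (h : Inserts t x t' i)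
    (hs : shape t = shape q) : RSKstep (t, q) x k = (t', placeAt q i k) := by
  have hi : i ≤ (shape t).length := by simpa [shape] using h.le_length
  simp [RSKstep, h.insertTab_eq, h.shape_eq, diffRow_addBox _ _ hi]

theorem RSKfold_concat (xs : List ℕ) (x : ℕ) :
    RSKfold (xs ++ [x]) = RSKstep (RSKfold xs) x (xs.length + 1) := by
  simp [RSKfold, List.range_succ, List.zip_append]

theorem rowAbove_nil (r : List ℕ) : RowAbove r [] := by simp [RowAbove]

theorem RowAbove.insert {l m s s' : List ℕ} {x y : ℕ} (hr : (l ++ y :: m).Pairwise (· < ·))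
    (hl : ∀ a ∈ l, a < x) (hxy : x < y)
    (h : RowAbove (l ++ y :: m) s) (hs : RowStep s y s') : RowAbove (l ++ x :: m) s' := by
  have key : ∀ l2 : List ℕ, (∀ a ∈ l2, a < y) → l2 <+: s → l2.length ≤ l.length := by
    intro l2 h2 ⟨u, hu⟩
    by_contra! hlt
    obtain ⟨a, ha, hab⟩ := h l.length l2[l.length] (by rw [← hu]; grind)
    have := h2 l2[l.length] (by simp)
    grind
  have front : ∀ j ≤ l.length, ∃ a, (l ++ x :: m)[j]? = some a ∧ a < y := by
    clear key
    intro j hj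
    rcases hj.lt_or_eq with hj | rfl
    · refine ⟨l[j], by grind, ?_⟩
      have := hl l[j] (by simp)
      omega
    · exact ⟨x, by simp, hxy⟩
  clear hr
  intro j b hb
  rcases hs with ⟨rfl, h2⟩ | ⟨l2, z, m2, rfl, rfl, h2, hyz⟩
  · have hle := key s h2 (by simp)
    clear key
    have := h j
    rcases lt_trichotomy j s.length with hj | hj | hj
    · clear front; grind
    · obtain ⟨a, ha, hay⟩ := front j (by omega)
      refine ⟨a, ha, ?_⟩
      clear front this h
      grind
    · clear front; grind
  · have hle := key l2 h2 (by simp)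
    clear key
    have := h j
    rcases eq_or_ne j l2.length with hj | hj
    · obtain ⟨a, ha, hay⟩ := front j (by omega)
      refine ⟨a, ha, ?_⟩
      clear front this h
      grind
    · have hb' : (l2 ++ z :: m2)[j]? = some b := by
        clear front this h
        grind
      obtain ⟨a, ha, hab⟩ := this b hb'
      clear front h this
      rcases eq_or_ne j l.length with hj | hj
      · exact ⟨x, by simp [hj], by grind⟩
      · exact ⟨a, by grind, hab⟩

theorem RowAbove.delete {l m s s' : List ℕ} {x y : ℕ} (hs1 : s.Pairwise (· < ·))
    (hm : ∀ a ∈ m, y < a) (h : RowAbove (l ++ x :: m) s') (hs : RowStep s y s') :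
    RowAbove (l ++ y :: m) s := by
  have key : ∀ l2 : List ℕ, s'[l2.length]? = some y → l2.length ≤ l.length := by
    intro l2 h2
    by_contra! hlt
    obtain ⟨a, ha, hab⟩ := h l2.length y h2
    have : a ∈ m := by grind
    have := hm a this
    omega
  intro j b hb
  rcases hs with ⟨rfl, h2⟩ | ⟨l2, z, m2, rfl, rfl, h2, hyz⟩
  · have := key s (by simp)
    have := h j
    grind
  · have := key l2 (by simp)
    have := h j
    simp [List.pairwise_append] at hs1
    rcases lt_trichotomy j l2.length with hj | hj | hj <;> grind

theorem exists_split_lt {r : List ℕ} {x : ℕ} (hx : x ∉ r) :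
    (∀ a ∈ r, a < x) ∨ ∃ l y m, r = l ++ y :: m ∧ (∀ a ∈ l, a < x) ∧ x < y := by
  induction r with
  | nil => simp
  | cons a r ih =>
    simp at hx
    rcases lt_or_gt_of_ne hx.1 with h | h
    · exact Or.inr ⟨[], a, r, by simp, by simp, h⟩
    · rcases ih hx.2 with h' | ⟨l, y, m, rfl, hl, hy⟩
      · left; grind
      · exact Or.inr ⟨a :: l, y, m, by simp, by grind, hy⟩

theorem exists_split_gt {r : List ℕ} {y : ℕ} (hr : r.Pairwise (· < ·)) (hy : y ∉ r)
    (h : ∃ a ∈ r, a < y) :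
    ∃ l x m, r = l ++ x :: m ∧ (∀ a ∈ l, a < x) ∧ x < y ∧ ∀ a ∈ m, y < a := by
  induction r with
  | nil => simp at h
  | cons a r ih =>
    by_cases h' : ∃ b ∈ r, b < y
    · obtain ⟨l, x, m, rfl, hl, hxy, hm⟩ := ih (by grind) (by grind) h'
      exact ⟨a :: l, x, m, by simp, by grind, hxy, hm⟩
    · refine ⟨[], a, r, by simp, by simp, by grind, ?_⟩
      grind

theorem split_unique {l₁ l₂ m₁ m₂ : List ℕ} {x₁ x₂ y : ℕ}
    (hr : (l₁ ++ x₁ :: m₁).Pairwise (· < ·)) (h : l₁ ++ x₁ :: m₁ = l₂ ++ x₂ :: m₂)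
    (hx₁ : x₁ < y) (hx₂ : x₂ < y) (hm₁ : ∀ a ∈ m₁, y < a) (hm₂ : ∀ a ∈ m₂, y < a) :
    l₁ = l₂ ∧ x₁ = x₂ ∧ m₁ = m₂ := by
  induction l₁ generalizing l₂ with
  | nil => cases l₂ <;> grind
  | cons a l₁ ih =>
    cases l₂ with
    | nil => grind
    | cons b l₂ =>
      simp at h
      have := ih (l₂ := l₂) (by grind) h.2
      grind

theorem RowAbove.append_left {r s : List ℕ} (h : RowAbove r s) (u : List ℕ) :
    RowAbove (r ++ u) s := by
  intro j b hb
  obtain ⟨a, ha, hab⟩ := h j b hb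
  exact ⟨a, by grind, hab⟩

theorem RowAbove.of_append_right {r s u : List ℕ} (h : RowAbove r (s ++ u)) : RowAbove r s := by
  intro j b hb
  exact h j b (by grind)

theorem RowAbove.of_append_left {r u s : List ℕ} (h : RowAbove (r ++ u) s)
    (hs : s.length ≤ r.length) : RowAbove r s := by
  intro j b hb
  obtain ⟨a, ha, hab⟩ := h j b hb
  exact ⟨a, by grind, hab⟩

theorem RowAbove.append_right {r s : List ℕ} {k : ℕ} (h : RowAbove r s)
    (hs : s.length < r.length) (hk : ∀ a ∈ r, a < k) : RowAbove r (s ++ [k]) := by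
  intro j b hb
  rcases eq_or_ne j s.length with rfl | hj
  · have := hk r[s.length] (by simp)
    exact ⟨r[s.length], by simp, by grind⟩
  · exact h j b (by grind)

theorem RowAbove.length_le {r s : List ℕ} (h : RowAbove r s) : s.length ≤ r.length := by
  by_contra! hlt
  obtain ⟨a, ha, -⟩ := h r.length s[r.length] (by simp)
  simp at ha

theorem IsStrictTableau.pos_of_mem_shape {t : List (List ℕ)} (ht : IsStrictTableau t) :
    ∀ a ∈ shape t, 0 < a := by
  induction t with
  | nil => simp [shape]
  | cons r rest ih =>
    obtain ⟨-, h2, -, h4⟩ := ht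
    have := ih h4
    simp_all [shape, List.length_pos_iff]

theorem IsStrictTableau.isChain_shape {t : List (List ℕ)} (ht : IsStrictTableau t) :
    (shape t).IsChain (· ≥ ·) := by
  induction t with
  | nil => simp [shape]
  | cons r rest ih =>
    obtain ⟨-, -, h3, h4⟩ := ht
    cases rest with
    | nil => simp [shape]
    | cons s rest =>
      have := ih h4
      have := h3.length_le
      simp_all [shape]

theorem exists_inserts {t : List (List ℕ)} {x : ℕ} (ht : t.flatten.Nodup)
    (hx : x ∉ t.flatten) : ∃ t' i, Inserts t x t' i := by
  induction t generalizing x with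
  | nil => exact ⟨_, _, .nil x⟩
  | cons r rest ih =>
    simp only [List.flatten_cons, List.mem_append, not_or] at hx
    rcases exists_split_lt hx.1 with h | ⟨l, y, m, rfl, hl, hxy⟩
    · exact ⟨_, _, .append h⟩
    · simp only [List.flatten_cons, List.nodup_append] at ht
      obtain ⟨t', i, h⟩ := ih (x := y) ht.2.1 (fun hy => ht.2.2 y (by simp) y hy rfl)
      exact ⟨_, _, .bump hl hxy h⟩

theorem Inserts.isStrictTableau {t t' : List (List ℕ)} {x i : ℕ} (h : Inserts t x t' i)
    (ht : IsStrictTableau t) : IsStrictTableau t' := by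
  induction h with
  | nil x => simp [IsStrictTableau, rowAbove_nil]
  | append h =>
    obtain ⟨h1, h2, h3, h4⟩ := ht
    exact ⟨by simpa [List.pairwise_append] using ⟨h1, h⟩, by simp, h3.append_left _, h4⟩
  | bump hl hxy h ih =>
    obtain ⟨h1, h2, h3, h4⟩ := ht
    refine ⟨?_, by simp, h3.insert h1 hl hxy h.rowStep, ih h4⟩
    simp only [List.pairwise_append, List.pairwise_cons, List.mem_cons] at h1 ⊢
    grind

theorem RowStep.mem {s s' : List ℕ} {x : ℕ} (h : RowStep s x s') : x ∈ s' := by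
  rcases h with ⟨rfl, -⟩ | ⟨l, y, m, -, rfl, -⟩ <;> simp

theorem headD_mem_flatten {t : List (List ℕ)} {x : ℕ} (h : x ∈ t.headD []) : x ∈ t.flatten := by
  cases t <;> simp_all

theorem IsStrictTableau.exists_inserts {t' : List (List ℕ)} {l : List ℕ} {i : ℕ}
    (ht : IsStrictTableau t') (hn : t'.flatten.Nodup) (hs : shape t' = addBox l i)
    (hpos : ∀ a ∈ l, 0 < a) (hl : l.IsChain (· ≥ ·)) (hi : i ≤ l.length) :
    ∃ t x, Inserts t x t' i ∧ IsStrictTableau t := by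
  induction t' generalizing l i with
  | nil => exact absurd hs.symm (addBox_ne_nil _ _)
  | cons r rest ih =>
    obtain ⟨h1, h2, h3, h4⟩ := ht
    cases l with
    | nil =>
      simp [addBox, shape] at hs hi
      obtain ⟨hs, rfl⟩ := hs
      obtain ⟨x, rfl⟩ := List.length_eq_one_iff.1 hs
      subst hi
      exact ⟨[], x, .nil x, trivial⟩
    | cons a as =>
      cases i with
      | zero =>
        simp only [addBox, shape, List.map_cons, List.cons.injEq] at hs
        obtain ⟨r, x, rfl⟩ : ∃ r₀ x, r = r₀ ++ [x] :=
          ⟨r.dropLast, r.getLast h2, (List.dropLast_append_getLast h2).symm⟩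
        simp [List.pairwise_append] at h1 hs
        have ha : 0 < a := hpos a (by simp)
        refine ⟨r :: rest, x, .append h1.2, h1.1, ?_, h3.of_append_left ?_, h4⟩
        · rintro rfl
          simp at hs
          omega
        · cases rest with
          | nil => simp
          | cons s rest =>
            obtain ⟨hs, rfl⟩ := hs
            simp at hl
            simp
            omega
      | succ i =>
        simp only [addBox, shape, List.map_cons, List.cons.injEq] at hs
        simp only [List.flatten_cons, List.nodup_append] at hn
        obtain ⟨t, y, hins, ht⟩ := ih h4 hn.2.1 hs.2 (fun b hb => hpos b (by simp [hb]))
          hl.tail (by simpa using hi)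
        have hy := hins.rowStep.mem
        have hyr : y ∉ r := fun h => hn.2.2 y h y (headD_mem_flatten hy) rfl
        obtain ⟨j, hj⟩ := List.mem_iff_getElem?.1 hy
        obtain ⟨b, hb, hby⟩ := h3 j y hj
        obtain ⟨l, x, m, rfl, hl, hxy, hm⟩ :=
          exists_split_gt h1 hyr ⟨b, List.mem_of_getElem? hb, hby⟩
        refine ⟨_, x, .bump hl hxy hins, ?_, by simp, ?_, ht⟩
        · simp only [List.pairwise_append, List.pairwise_cons, List.mem_cons] at h1 ⊢
          grind
        · refine h3.delete ?_ hm hins.rowStep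
          cases t with
          | nil => simp
          | cons s t => exact ht.1

theorem Inserts.unique {t₁ t₂ t₁' t₂' : List (List ℕ)} {x₁ x₂ i : ℕ} (h₁ : Inserts t₁ x₁ t₁' i)
    (h₂ : Inserts t₂ x₂ t₂' i) (h : t₁' = t₂') (ht₁ : IsStrictTableau t₁)
    (ht₂ : IsStrictTableau t₂) : t₁ = t₂ ∧ x₁ = x₂ := by
  induction h₁ generalizing t₂ x₂ t₂' with
  | nil x =>
    cases h₂ with
    | nil => simpa using h
    | @append r =>
      have := ht₂.2.1
      cases r <;> simp_all
  | @append r rest x h' =>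
    cases h₂ with
    | nil =>
      have := ht₁.2.1
      cases r <;> simp_all
    | append => simp_all
  | bump hl hxy h' ih =>
    cases h₂ with
    | bump hl₂ hxy₂ h₂' =>
      simp only [List.cons.injEq] at h
      obtain ⟨h, rfl⟩ := h
      obtain ⟨rfl, rfl⟩ := ih h₂' rfl ht₁.2.2.2 ht₂.2.2.2
      have hr₁ := ht₁.1
      have hr₂ := ht₂.1
      have hm₁ := (List.pairwise_cons.1 (List.pairwise_append.1 hr₁).2.1)
      have hm₂ := (List.pairwise_cons.1 (List.pairwise_append.1 hr₂).2.1)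
      have hr : (_ ++ _ :: _).Pairwise (· < ·) := (Inserts.bump hl hxy h').isStrictTableau ht₁ |>.1
      obtain ⟨rfl, rfl, rfl⟩ := split_unique hr h hxy hxy₂ hm₁.1 hm₂.1
      simp

theorem headD_placeAt (q : List (List ℕ)) (i k : ℕ) :
    (placeAt q i k).headD [] = q.headD [] ∨
      (placeAt q i k).headD [] = q.headD [] ++ [k] := by
  fun_cases placeAt q i k <;> simp

theorem IsStrictTableau.placeAt {q : List (List ℕ)} {i k : ℕ} (hq : IsStrictTableau q)
    (hk : ∀ a ∈ q.flatten, a < k) (hs : (shape (placeAt q i k)).IsChain (· ≥ ·)) :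
    IsStrictTableau (placeAt q i k) := by
  induction q generalizing i with
  | nil => simp [_root_.placeAt, IsStrictTableau, rowAbove_nil]
  | cons r q ih =>
    obtain ⟨h1, h2, h3, h4⟩ := hq
    cases i with
    | zero =>
      refine ⟨?_, by simp, h3.append_left _, h4⟩
      simp only [List.pairwise_append]
      grind
    | succ i =>
      simp only [_root_.placeAt, shape, List.map_cons] at hs
      refine ⟨h1, h2, ?_,
        ih h4 (fun a ha => hk a (List.mem_append_right r ha)) hs.tail⟩
      have hlen : ((_root_.placeAt q i k).headD []).length ≤ r.length := by
        cases h : _root_.placeAt q i k <;> simp_all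
      rcases headD_placeAt q i k with h | h
      · rwa [h]
      · rw [h] at hlen ⊢
        exact h3.append_right (by simpa using hlen) (fun a ha => hk a (by simp [ha]))

theorem placeAt_injective {q₁ q₂ : List (List ℕ)} {i₁ i₂ k : ℕ} (hq₁ : IsStrictTableau q₁)
    (hq₂ : IsStrictTableau q₂) (hk₁ : k ∉ q₁.flatten) (hk₂ : k ∉ q₂.flatten)
    (hi₁ : i₁ ≤ q₁.length) (hi₂ : i₂ ≤ q₂.length) (h : placeAt q₁ i₁ k = placeAt q₂ i₂ k) :
    q₁ = q₂ ∧ i₁ = i₂ := by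
  induction q₁ generalizing q₂ i₁ i₂ with
  | nil =>
    have : i₁ = 0 := by simpa using hi₁
    subst this
    cases q₂ with
    | nil => simp_all
    | cons r q₂ =>
      have := hq₂.2.1
      cases i₂ with
      | zero => cases r <;> simp_all [placeAt]
      | succ i₂ =>
        simp only [placeAt, List.cons.injEq] at h
        simp [← h.1] at hk₂
  | cons r₁ q₁ ih =>
    have hr₁ := hq₁.2.1
    cases q₂ with
    | nil =>
      cases i₁ with
      | zero => cases r₁ <;> simp_all [placeAt]
      | succ i₁ =>
        simp only [placeAt, List.cons.injEq] at h
        simp [h.1] at hk₁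
    | cons r₂ q₂ =>
      simp only [List.flatten_cons, List.mem_append, not_or] at hk₁ hk₂
      cases i₁ <;> cases i₂ <;> simp only [placeAt, List.cons.injEq] at h
      · simp_all
      · exact absurd (h.1 ▸ (by simp : k ∈ r₁ ++ [k])) hk₂.1
      · exact absurd (h.1.symm ▸ (by simp : k ∈ r₂ ++ [k])) hk₁.1
      · have := ih hq₁.2.2.2 hq₂.2.2.2 hk₁.2 hk₂.2 (by simpa using hi₁) (by simpa using hi₂) h.2
        simp_all

theorem IsStrictTableau.exists_placeAt {q' : List (List ℕ)} {k : ℕ} (hq : IsStrictTableau q')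
    (hk : k ∈ q'.flatten) (hmax : ∀ a ∈ q'.flatten, a ≤ k) :
    ∃ q i, q' = _root_.placeAt q i k ∧ IsStrictTableau q ∧ i ≤ q.length := by
  induction q' with
  | nil => simp at hk
  | cons r rest ih =>
    obtain ⟨h1, h2, h3, h4⟩ := hq
    by_cases hr : k ∈ r
    · obtain ⟨r, x, rfl⟩ : ∃ r₀ x, r = r₀ ++ [x] :=
        ⟨r.dropLast, r.getLast h2, (List.dropLast_append_getLast h2).symm⟩
      have hx : x ≤ k := hmax x (by simp)
      simp only [List.pairwise_append, List.mem_singleton] at h1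
      obtain rfl : x = k := by
        simp only [List.mem_append, List.mem_singleton] at hr
        rcases hr with hr | hr
        · have := h1.2.2 k hr x rfl
          omega
        · exact hr.symm
      have hlen : (rest.headD []).length ≤ r.length := by
        by_contra! hlt
        obtain ⟨a, ha, hab⟩ := h3 r.length (rest.headD [])[r.length] (by simp)
        have := hmax (rest.headD [])[r.length]
          (List.mem_append_right _ (headD_mem_flatten (List.getElem_mem hlt)))
        simp at ha
        omega
      rcases eq_or_ne r [] with rfl | hr₀
      · cases rest with
        | nil => exact ⟨[], 0, rfl, trivial, le_rfl⟩
        | cons s rest => exact absurd (by simpa using hlen) h4.2.1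
      · exact ⟨r :: rest, 0, rfl, ⟨h1.1, hr₀, h3.of_append_left hlen, h4⟩, by simp⟩
    · obtain ⟨q, i, rfl, hq, hi⟩ := ih h4 (by simpa [hr] using hk)
        (fun a ha => hmax a (by simp_all))
      refine ⟨r :: q, i + 1, rfl, ⟨h1, h2, ?_, hq⟩, by simpa using hi⟩
      rcases headD_placeAt q i k with h | h
      · rwa [h] at h3
      · exact (h ▸ h3).of_append_right

theorem rowAbove_iff (r s : List ℕ) :
    RowAbove r s ↔ s.length ≤ r.length ∧ ∀ j < s.length, r.getD j 0 < s.getD j 0 := by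
  constructor
  · intro h
    refine ⟨h.length_le, fun j hj => ?_⟩
    obtain ⟨a, ha, hab⟩ := h j s[j] (by simp)
    simpa [List.getD_eq_getElem?_getD, ha, hj] using hab
  · rintro ⟨hle, h⟩ j b hb
    obtain ⟨hj, rfl⟩ := List.getElem?_eq_some_iff.1 hb
    refine ⟨r[j], by simp, ?_⟩
    simpa [List.getD_eq_getElem?_getD, hj, hj.trans_le hle] using h j hj

theorem isStrictTableau_iff (t : List (List ℕ)) :
    IsStrictTableau t ↔ (∀ r ∈ t, r.IsChain (· < ·)) ∧
      (∀ i j, j < (t.getD (i + 1) []).length →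
        (t.getD i []).getD j 0 < (t.getD (i + 1) []).getD j 0) ∧
      (shape t).IsChain (· ≥ ·) ∧ (∀ r ∈ t, r ≠ []) := by
  induction t with
  | nil => simp [IsStrictTableau, shape]
  | cons r rest ih =>
    have hhead : rest.getD 0 [] = rest.headD [] := by cases rest <;> simp
    have hchain : (shape (r :: rest)).IsChain (· ≥ ·) ↔
        (rest.headD []).length ≤ r.length ∧ (shape rest).IsChain (· ≥ ·) := by
      cases rest <;> simp [shape]
    have hrow : r.IsChain (· < ·) ↔ r.Pairwise (· < ·) := List.isChain_iff_pairwise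
    have hcol : (∀ i j, j < ((r :: rest).getD (i + 1) []).length →
          ((r :: rest).getD i []).getD j 0 < ((r :: rest).getD (i + 1) []).getD j 0) ↔
        (∀ j < (rest.headD []).length, r.getD j 0 < (rest.headD []).getD j 0) ∧
          ∀ i j, j < (rest.getD (i + 1) []).length →
            (rest.getD i []).getD j 0 < (rest.getD (i + 1) []).getD j 0 := by
      constructor
      · intro h
        refine ⟨fun j hj => ?_, fun i j hj => h (i + 1) j hj⟩
        simpa only [List.getD_cons_zero, List.getD_cons_succ, hhead] using
          h 0 j (by simpa only [List.getD_cons_succ, hhead] using hj)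
      · rintro ⟨h0, h⟩ (_ | i) j hj
        · simp only [List.getD_cons_zero, List.getD_cons_succ, hhead] at hj ⊢
          exact h0 j hj
        · exact h i j hj
    rw [IsStrictTableau, ih, hchain, hcol, rowAbove_iff, List.forall_mem_cons,
      List.forall_mem_cons, hrow]
    tauto

theorem isStdTableau_iff (n : ℕ) (t : List (List ℕ)) :
    IsStdTableau n t ↔
      t.flatten.Perm ((List.range n).map (· + 1)) ∧ IsStrictTableau t := by
  rw [isStrictTableau_iff]
  rfl

theorem IsStdTableau.le_of_mem {n : ℕ} {t : List (List ℕ)} (ht : IsStdTableau n t) {a : ℕ}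
    (ha : a ∈ t.flatten) : a ≤ n := by
  have := ht.1.mem_iff.1 ha
  simp at this
  omega

theorem RSKfold_spec {xs : List ℕ} (hxs : xs.Nodup) :
    IsStrictTableau (RSKfold xs).1 ∧ (RSKfold xs).1.flatten.Perm xs ∧
      IsStdTableau xs.length (RSKfold xs).2 ∧ shape (RSKfold xs).1 = shape (RSKfold xs).2 := by
  induction xs using List.reverseRecOn with
  | nil => simp [RSKfold, isStdTableau_iff, IsStrictTableau]
  | append_singleton xs x ih =>
    rw [List.nodup_append] at hxs
    obtain ⟨h1, h2, h3, h4⟩ := ih hxs.1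
    have hx : x ∉ (RSKfold xs).1.flatten := fun h =>
      hxs.2.2 x (h2.mem_iff.1 h) x (by simp) rfl
    obtain ⟨t', i, h⟩ := exists_inserts (h2.nodup_iff.2 hxs.1) hx
    have hsh : shape t' = shape (placeAt (RSKfold xs).2 i (xs.length + 1)) := by
      rw [h.shape_eq, shape_placeAt, h4]
    have ht' := h.isStrictTableau h1
    rw [RSKfold_concat, RSKstep_eq _ h h4]
    refine ⟨ht', ?_, (isStdTableau_iff _ _).2 ⟨?_, ?_⟩, hsh⟩
    · exact h.perm.trans ((h2.cons x).trans (by simpa using (List.perm_append_singleton x xs).symm))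
    · refine (perm_placeAt _ _ _).trans ((h3.1.cons _).trans ?_)
      simpa [List.range_succ] using (List.perm_append_singleton _ _).symm
    · exact ((isStdTableau_iff _ _).1 h3).2.placeAt
        (fun a ha => Nat.lt_succ_of_le (h3.le_of_mem ha)) (hsh ▸ ht'.isChain_shape)

theorem RSKfold_injective {xs ys : List ℕ} (hxs : xs.Nodup) (hys : ys.Nodup)
    (hlen : xs.length = ys.length) (h : RSKfold xs = RSKfold ys) : xs = ys := by
  induction xs using List.reverseRecOn generalizing ys with
  | nil => exact (List.length_eq_zero_iff.1 hlen.symm).symm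
  | append_singleton xs x ih =>
    obtain ⟨ys, y, rfl⟩ : ∃ ys₀ y, ys = ys₀ ++ [y] := by
      have hy : ys ≠ [] := by rintro rfl; simp at hlen
      exact ⟨ys.dropLast, ys.getLast hy, (List.dropLast_append_getLast hy).symm⟩
    have hlen' : xs.length = ys.length := by simpa using hlen
    rw [List.nodup_append] at hxs hys
    obtain ⟨p1, p2, p3, p4⟩ := RSKfold_spec hxs.1
    obtain ⟨q1, q2, q3, q4⟩ := RSKfold_spec hys.1
    obtain ⟨t, i, hi⟩ := exists_inserts (p2.nodup_iff.2 hxs.1) (x := x) fun h =>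
      hxs.2.2 x (p2.mem_iff.1 h) x (by simp) rfl
    obtain ⟨u, j, hj⟩ := exists_inserts (q2.nodup_iff.2 hys.1) (x := y) fun h =>
      hys.2.2 y (q2.mem_iff.1 h) y (by simp) rfl
    rw [RSKfold_concat, RSKfold_concat, RSKstep_eq _ hi p4, RSKstep_eq _ hj q4, ← hlen',
      Prod.mk.injEq] at h
    rw [← hlen'] at q3
    have hp := congrArg List.length p4
    have hq := congrArg List.length q4
    simp only [shape, List.length_map] at hp hq
    obtain ⟨hQ, rfl⟩ := placeAt_injective ((isStdTableau_iff _ _).1 p3).2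
      ((isStdTableau_iff _ _).1 q3).2 (fun h => by have := p3.le_of_mem h; omega)
      (fun h => by have := q3.le_of_mem h; omega) (hp ▸ hi.le_length) (hq ▸ hj.le_length) h.2
    obtain ⟨hP, rfl⟩ := hi.unique hj h.1 p1 q1
    rw [ih hxs.1 hys.1 hlen' (Prod.ext hP hQ)]

theorem RSKfold_surjective {n : ℕ} {p q : List (List ℕ)} (hp : IsStrictTableau p)
    (hn : p.flatten.Nodup) (hq : IsStdTableau n q) (hs : shape p = shape q) :
    ∃ xs, xs.Perm p.flatten ∧ xs.length = n ∧ RSKfold xs = (p, q) := by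
  induction n generalizing p q with
  | zero =>
    have hq' := ((isStdTableau_iff _ _).1 hq).2
    obtain rfl : q = [] := by
      cases q with
      | nil => rfl
      | cons r q => exact absurd (by simpa using hq.1 : _ ∧ _).1 hq'.2.1
    obtain rfl : p = [] := by simpa [shape] using hs
    exact ⟨[], by simp, rfl, rfl⟩
  | succ n ih =>
    obtain ⟨hperm, hq'⟩ := (isStdTableau_iff _ _).1 hq
    obtain ⟨q, i, rfl, hq₀, hi⟩ := hq'.exists_placeAt (k := n + 1)
      (hperm.mem_iff.2 (by simp)) (fun a ha => hq.le_of_mem ha)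
    have hstd : IsStdTableau n q := by
      refine (isStdTableau_iff _ _).2 ⟨?_, hq₀⟩
      have := (perm_placeAt q i (n + 1)).symm.trans hperm
      rw [List.range_succ, List.map_append] at this
      exact (this.trans (List.perm_append_singleton _ _)).cons_inv
    rw [shape_placeAt] at hs
    obtain ⟨t, x, hins, ht⟩ := hp.exists_inserts hn hs hq₀.pos_of_mem_shape
      hq₀.isChain_shape (by simpa [shape] using hi)
    have hsh : shape t = shape q := addBox_injective ht.pos_of_mem_shape hq₀.pos_of_mem_shape
      (hins.shape_eq.symm.trans hs)
    obtain ⟨xs, hxs, hlen, hfold⟩ := ih ht (hins.perm.nodup_iff.1 hn).of_cons hstd hsh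
    refine ⟨xs ++ [x], ?_, by simp [hlen], ?_⟩
    · exact (List.perm_append_singleton x xs).trans ((hxs.cons x).trans hins.perm.symm)
    · rw [RSKfold_concat, hfold, hlen, RSKstep_eq _ hins hsh]

theorem nodup_ofFn_perm {n : ℕ} (w : Equiv.Perm (Fin n)) :
    (List.ofFn fun i => (w i : ℕ) + 1).Nodup := by
  rw [List.nodup_ofFn]
  intro i j h
  simpa [Fin.val_inj] using h

theorem exists_perm_of_list {n : ℕ} {xs : List ℕ}
    (h : xs.Perm ((List.range n).map (· + 1))) :
    ∃ w : Equiv.Perm (Fin n), (List.ofFn fun i => (w i : ℕ) + 1) = xs := by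
  obtain rfl : xs.length = n := by simpa using h.length_eq
  have hmem : ∀ i : Fin xs.length, 0 < xs[i] ∧ xs[i] ≤ xs.length := by
    intro i
    have := h.mem_iff.1 (List.getElem_mem i.2)
    simp at this
    simp
    omega
  have hnd : xs.Nodup := h.nodup_iff.2 (List.nodup_range.map (add_left_injective 1))
  let f : Fin xs.length → Fin xs.length := fun i => ⟨xs[i] - 1, by have := hmem i; omega⟩
  have hf : Function.Injective f := by
    intro i j hij
    have h1 := hmem i
    have h2 := hmem j
    have h3 : xs[i] = xs[j] := by
      have := congrArg Fin.val hij
      simp only [f] at this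
      omega
    exact Fin.ext ((hnd.getElem_inj_iff).1 h3)
  refine ⟨Equiv.ofBijective f (Finite.injective_iff_bijective.1 hf), ?_⟩
  refine List.ext_getElem (by simp) fun i h1 h2 => ?_
  have := hmem ⟨i, h2⟩
  simp [f] at this ⊢
  omega

/-- the RSK correspondence `w ↦ (P(w), Q(w))` is a bijection from `S_n`
onto the set of pairs of standard tableaux with `n` boxes of the same shape. -/
theorem RSK_bijective (n : ℕ) :
    Set.BijOn (fun w : Equiv.Perm (Fin n) => (Ptab w, Qtab w)) Set.univ
      {pq : List (List ℕ) × List (List ℕ) |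
        IsStdTableau n pq.1 ∧ IsStdTableau n pq.2 ∧ shape pq.1 = shape pq.2} := by
  refine ⟨fun w _ => ?_, fun v _ w _ h => ?_, ?_⟩
  · have hperm : (List.ofFn fun i => (w i : ℕ) + 1).Perm ((List.range n).map (· + 1)) := by
      refine (List.perm_ext_iff_of_nodup (nodup_ofFn_perm w)
        (List.nodup_range.map (add_left_injective 1))).2 fun a => ?_
      simp only [List.mem_ofFn, List.mem_map, List.mem_range]
      constructor
      · rintro ⟨i, rfl⟩
        exact ⟨w i, (w i).2, rfl⟩
      · rintro ⟨b, hb, rfl⟩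
        exact ⟨w.symm ⟨b, hb⟩, by simp⟩
    obtain ⟨h1, h2, h3, h4⟩ := RSKfold_spec (nodup_ofFn_perm w)
    rw [List.length_ofFn] at h3
    exact ⟨(isStdTableau_iff _ _).2 ⟨h2.trans hperm, h1⟩, h3, h4⟩
  · have := RSKfold_injective (nodup_ofFn_perm v) (nodup_ofFn_perm w) (by simp) h
    ext i
    simpa using congrFun (List.ofFn_injective this) i
  · rintro ⟨p, q⟩ ⟨hp, hq, hs⟩
    obtain ⟨hperm, hp⟩ := (isStdTableau_iff _ _).1 hp
    have hn := hperm.nodup_iff.2 (List.nodup_range.map (add_left_injective 1))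
    obtain ⟨xs, hxs, -, hfold⟩ := RSKfold_surjective hp hn hq hs
    obtain ⟨w, hw⟩ := exists_perm_of_list (hxs.trans hperm)
    exact ⟨w, trivial, by simp only [Ptab, Qtab, hw, hfold]⟩
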